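/- arXiv:1306.2217 — 6 statements merged into one kernel-verified Lean document; each statement's English description precedes it below -/
import Mathlib

section
/- Let G = (V,E) be a finite simple graph with maximum degree at most Δ, where Δ ≥ 1, let v ∈ V and let k ≥ 1. Then the number of k-element subsets S ⊆ V with v ∈ S such that the induced subgraph G[S] is connected is at most 4^k · Δ^{2k}. -/
open Classical

/-- Number of edges of `G` with both endpoints in `S`. -/
noncomputable def edgesWithin {V : Type*} (G : SimpleGraph V) (S : Set V) : ℕ :=
  {e ∈ G.edgeSet | ∀ v ∈ e, v ∈ S}.ncard

/-- Number of edges of `G` with exactly one endpoint in `S` (the cut `E(S, V∖S)`). -/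
noncomputable def cutEdges {V : Type*} (G : SimpleGraph V) (S : Set V) : ℕ :=
  {e ∈ G.edgeSet | (∃ v ∈ e, v ∈ S) ∧ ∃ v ∈ e, v ∉ S}.ncard

/-- Number of edges of `G` with one endpoint in `X` and the other in `Y`
(for disjoint `X`, `Y`). -/
noncomputable def edgesBetween {V : Type*} (G : SimpleGraph V) (X Y : Set V) : ℕ :=
  {e ∈ G.edgeSet | (∃ v ∈ e, v ∈ X) ∧ ∃ v ∈ e, v ∈ Y}.ncard

/-- `val(S) = α₁·|E(S)| + α₂·|E(S, V∖S)|`. -/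
noncomputable def valFn {V : Type*} (G : SimpleGraph V) (α₁ α₂ : ℝ) (S : Set V) : ℝ :=
  α₁ * edgesWithin G S + α₂ * cutEdges G S

/-- Contribution `δ(v,T) = (α₁/2)·|E({v},T)| + α₂·|E({v},V∖T)|`. -/
noncomputable def contrib {V : Type*} (G : SimpleGraph V) (α₁ α₂ : ℝ) (v : V)
    (T : Set V) : ℝ :=
  α₁ / 2 * ({u | G.Adj v u ∧ u ∈ T}.ncard : ℝ) +
    α₂ * ({u | G.Adj v u ∧ u ∉ T}.ncard : ℝ)

/-- Closed neighborhood of a set of vertices. -/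
def closedNbhd {V : Type*} (G : SimpleGraph V) (A : Set V) : Set V :=
  A ∪ {u | ∃ a ∈ A, G.Adj a u}

/-- The number of vertex sets traversed by walks of length `n` from `v` is at most `Δ ^ n`. -/
theorem ncard_walk_supports_le {V : Type*} [Fintype V] (G : SimpleGraph V) (Δ : ℕ)
    (hdeg : ∀ u : V, (G.neighborSet u).ncard ≤ Δ) (n : ℕ) (v : V) :
    {T : Finset V | ∃ w, ∃ p : G.Walk v w, p.length = n ∧ p.support.toFinset = T}.ncard
      ≤ Δ ^ n := by
  induction n generalizing v with
  | zero =>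
    refine (Set.ncard_le_ncard (t := {{v}}) ?_).trans (by simp)
    rintro T ⟨w, p, hp, rfl⟩
    cases p with
    | nil => simp
    | cons h p => simp at hp
  | succ n ih =>
    set A : V → Set (Finset V) := fun u =>
      {T : Finset V | ∃ w, ∃ p : G.Walk u w, p.length = n ∧ p.support.toFinset = T}
    have hsub : {T : Finset V | ∃ w, ∃ p : G.Walk v w, p.length = n + 1 ∧
        p.support.toFinset = T} ⊆
        ⋃ u ∈ (G.neighborSet v).toFinset, (insert v) '' A u := by
      rintro T ⟨w, p, hp, rfl⟩
      cases p with
      | nil => simp at hp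
      | cons h p =>
        simp only [Set.mem_iUnion]
        refine ⟨_, by simpa using h, p.support.toFinset, ⟨_, p, by simpa using hp, rfl⟩, ?_⟩
        simp
    calc _ ≤ _ := Set.ncard_le_ncard hsub
      _ ≤ ∑ u ∈ (G.neighborSet v).toFinset, ((insert v) '' A u).ncard :=
        Finset.set_ncard_biUnion_le _ _
      _ ≤ ∑ _u ∈ (G.neighborSet v).toFinset, Δ ^ n :=
        Finset.sum_le_sum fun u _ => (Set.ncard_image_le (Set.toFinite _)).trans (ih u)
      _ = (G.neighborSet v).ncard * Δ ^ n := by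
        rw [Finset.sum_const, smul_eq_mul, Set.ncard_eq_toFinset_card']
      _ ≤ Δ * Δ ^ n := Nat.mul_le_mul_right _ (hdeg v)
      _ = Δ ^ (n + 1) := (pow_succ' _ _).symm

/-- A proper subset of a connected vertex set has an edge leaving it inside the set. -/
theorem exists_adj_of_induce_connected {V : Type*} (G : SimpleGraph V) {S T : Finset V}
    (hS : (G.induce (S : Set V)).Connected) {v : V} (hv : v ∈ T) (hTS : T ⊂ S) :
    ∃ x ∈ T, ∃ y ∈ S, y ∉ T ∧ G.Adj x y := by
  obtain ⟨y, hyS, hyT⟩ := Finset.exists_of_ssubset hTS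
  obtain ⟨p⟩ := hS.preconnected ⟨v, hTS.subset hv⟩ ⟨y, hyS⟩
  obtain ⟨d, -, h1, h2⟩ := p.exists_boundary_dart {x | (x : V) ∈ T} hv hyT
  exact ⟨d.fst, h1, d.snd, d.snd.2, h2, d.adj⟩

/-- A connected vertex set contains, around each of its vertices, closed walks of length `2 * n`
traversing exactly `n + 1` of its vertices. -/
theorem exists_closed_walk_of_induce_connected {V : Type*} (G : SimpleGraph V) {S : Finset V}
    (hS : (G.induce (S : Set V)).Connected) {v : V} (hv : v ∈ S) (n : ℕ) (hn : n < S.card) :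
    ∃ p : G.Walk v v, p.length = 2 * n ∧ p.support.toFinset ⊆ S ∧
      p.support.toFinset.card = n + 1 := by
  induction n with
  | zero => exact ⟨.nil, by simp [hv]⟩
  | succ n ih =>
    obtain ⟨p, hlen, hsub, hcard⟩ := ih (by omega)
    have hss : p.support.toFinset ⊂ S :=
      Finset.ssubset_iff_subset_ne.2 ⟨hsub, fun h => by rw [h] at hcard; omega⟩
    obtain ⟨x, hx, y, hy, hyp, hadj⟩ :=
      exists_adj_of_induce_connected G hS (v := v) (by simp) hss
    have hx' : x ∈ p.support := by simpa using hx
    obtain ⟨q, r, rfl⟩ := SimpleGraph.Walk.mem_support_iff_exists_append.1 hx'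
    have hsupp : (q.append (.cons hadj (.cons hadj.symm r))).support.toFinset =
        insert y (q.append r).support.toFinset := by
      ext z
      simp only [List.mem_toFinset, SimpleGraph.Walk.mem_support_append_iff,
        SimpleGraph.Walk.support_cons, List.mem_cons, Finset.mem_insert]
      have := q.end_mem_support
      grind
    refine ⟨q.append (.cons hadj (.cons hadj.symm r)), ?_, ?_, ?_⟩
    · simp only [SimpleGraph.Walk.length_append, SimpleGraph.Walk.length_cons] at hlen ⊢
      omega
    · rw [hsupp]
      exact Finset.insert_subset hy hsub
    · rw [hsupp, Finset.card_insert_of_notMem hyp, hcard]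

/-- In a graph of maximum degree at most `Δ ≥ 1`, the number of
`k`-element vertex subsets containing a given vertex `v` inducing a connected
subgraph is at most `4^k · Δ^(2k)`. -/
theorem connected_subsets_bound {V : Type*} [Fintype V] (G : SimpleGraph V)
    (Δ : ℕ) (hΔ : 1 ≤ Δ) (hdeg : ∀ u : V, (G.neighborSet u).ncard ≤ Δ)
    (v : V) (k : ℕ) (hk : 1 ≤ k) :
    {S : Finset V | v ∈ S ∧ S.card = k ∧ (G.induce (↑S : Set V)).Connected}.ncard
      ≤ 4 ^ k * Δ ^ (2 * k) := by
  obtain ⟨n, rfl⟩ : ∃ n, k = n + 1 := ⟨k - 1, by omega⟩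
  have hsub : {S : Finset V | v ∈ S ∧ S.card = n + 1 ∧ (G.induce (↑S : Set V)).Connected} ⊆
      {T : Finset V | ∃ w, ∃ p : G.Walk v w, p.length = 2 * n ∧ p.support.toFinset = T} := by
    rintro S ⟨hv, hcard, hS⟩
    obtain ⟨p, hlen, hpS, hp⟩ := exists_closed_walk_of_induce_connected G hS hv n (by omega)
    exact ⟨v, p, hlen, Finset.eq_of_subset_of_card_le hpS (by omega)⟩
  calc _ ≤ _ := Set.ncard_le_ncard hsub
    _ ≤ Δ ^ (2 * n) := ncard_walk_supports_le G Δ hdeg (2 * n) v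
    _ ≤ Δ ^ (2 * (n + 1)) := Nat.pow_le_pow_right hΔ (by omega)
    _ ≤ 4 ^ (n + 1) * Δ ^ (2 * (n + 1)) := Nat.le_mul_of_pos_left _ (by positivity)
end

section
/- (Lemma 'indep'.) Let G = (V,E) be a finite simple graph, α₁, α₂ real numbers, and let A, B, X, Y ⊆ V be pairwise disjoint sets of vertices such that val(A ∪ X) ≤ val(B ∪ X), N[A] ∩ Y = ∅ and N[B] ∩ Y = ∅. Then val(A ∪ X ∪ Y) ≤ val(B ∪ X ∪ Y). -/
open Classical

theorem edgesWithin_union {V : Type*} [Finite V] (G : SimpleGraph V) {S Y : Set V}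
    (h : Disjoint S Y) :
    edgesWithin G (S ∪ Y) = edgesWithin G S + edgesWithin G Y + edgesBetween G S Y := by
  have hd : ∀ v, v ∈ S → v ∉ Y := fun v hS hY => Set.disjoint_left.mp h hS hY
  unfold edgesWithin edgesBetween
  rw [← Set.ncard_union_eq, ← Set.ncard_union_eq]
  · congr 1
    ext e
    induction e with | _ a b =>
    simp only [Set.mem_union, Set.mem_ofPred_eq, Sym2.mem_iff, SimpleGraph.mem_edgeSet,
      forall_eq_or_imp, forall_eq, exists_eq_or_imp, exists_eq_left]
    grind
  all_goals
    rw [Set.disjoint_left]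
    intro e
    induction e with | _ a b =>
    simp only [Set.mem_union, Set.mem_ofPred_eq, Sym2.mem_iff, SimpleGraph.mem_edgeSet,
      forall_eq_or_imp, forall_eq, exists_eq_or_imp, exists_eq_left]
    grind

theorem cutEdges_union {V : Type*} [Finite V] (G : SimpleGraph V) {S Y : Set V}
    (h : Disjoint S Y) :
    cutEdges G (S ∪ Y) + 2 * edgesBetween G S Y = cutEdges G S + cutEdges G Y := by
  have hd : ∀ v, v ∈ S → v ∉ Y := fun v hS hY => Set.disjoint_left.mp h hS hY
  unfold cutEdges edgesBetween
  rw [← Set.ncard_union_add_ncard_inter {e ∈ G.edgeSet | (∃ v ∈ e, v ∈ S) ∧ ∃ v ∈ e, v ∉ S},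
    two_mul, ← add_assoc, ← Set.ncard_union_eq]
  · congr 2 <;>
    · ext e
      induction e with | _ a b =>
      simp only [Set.mem_union, Set.mem_inter_iff, Set.mem_ofPred_eq, Sym2.mem_iff,
        SimpleGraph.mem_edgeSet, exists_eq_or_imp, exists_eq_left]
      grind
  · rw [Set.disjoint_left]
    intro e
    induction e with | _ a b =>
    simp only [Set.mem_union, Set.mem_ofPred_eq, Sym2.mem_iff, SimpleGraph.mem_edgeSet,
      exists_eq_or_imp, exists_eq_left]
    grind

theorem edgesBetween_union_left {V : Type*} (G : SimpleGraph V) {A X Y : Set V}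
    (hAY : closedNbhd G A ∩ Y = ∅) : edgesBetween G (A ∪ X) Y = edgesBetween G X Y := by
  have hA : ∀ v ∈ A, v ∉ Y := fun v hv hY =>
    Set.eq_empty_iff_forall_notMem.mp hAY v ⟨Or.inl hv, hY⟩
  have hadj : ∀ v ∈ A, ∀ u, G.Adj v u → u ∉ Y := fun v hv u hvu hY =>
    Set.eq_empty_iff_forall_notMem.mp hAY u ⟨Or.inr ⟨v, hv, hvu⟩, hY⟩
  unfold edgesBetween
  congr 1
  ext e
  induction e with | _ a b =>
  simp only [Set.mem_union, Set.mem_ofPred_eq, Sym2.mem_iff, SimpleGraph.mem_edgeSet,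
    exists_eq_or_imp, exists_eq_left]
  grind [G.adj_comm a b]

theorem valFn_union {V : Type*} [Finite V] (G : SimpleGraph V) (α₁ α₂ : ℝ) {A X Y : Set V}
    (hXY : Disjoint X Y) (hAY : closedNbhd G A ∩ Y = ∅) :
    valFn G α₁ α₂ (A ∪ X ∪ Y) =
      valFn G α₁ α₂ (A ∪ X) + valFn G α₁ α₂ Y + (α₁ - 2 * α₂) * edgesBetween G X Y := by
  have hA : Disjoint A Y :=
    (Set.disjoint_iff_inter_eq_empty.mpr hAY).mono_left Set.subset_union_left
  have hd : Disjoint (A ∪ X) Y := Set.disjoint_union_left.mpr ⟨hA, hXY⟩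
  have hw := edgesWithin_union G hd
  have hc := cutEdges_union G hd
  rw [edgesBetween_union_left G hAY] at hw hc
  have hw' : (edgesWithin G (A ∪ X ∪ Y) : ℝ) =
    edgesWithin G (A ∪ X) + edgesWithin G Y + edgesBetween G X Y := mod_cast hw
  have hc' : (cutEdges G (A ∪ X ∪ Y) : ℝ) + 2 * edgesBetween G X Y =
    cutEdges G (A ∪ X) + cutEdges G Y := mod_cast hc
  unfold valFn
  linear_combination α₁ * hw' + α₂ * hc'

/-- Lemma "indep": If `A`, `B`, `X`, `Y` are pairwise disjoint,
`val(A ∪ X) ≤ val(B ∪ X)`, `N[A] ∩ Y = ∅` and `N[B] ∩ Y = ∅`, then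
`val(A ∪ X ∪ Y) ≤ val(B ∪ X ∪ Y)`. -/
theorem indep_lemma {V : Type*} [Fintype V] (G : SimpleGraph V) (α₁ α₂ : ℝ)
    (A B X Y : Set V)
    (hAB : Disjoint A B) (hAX : Disjoint A X) (hAY : Disjoint A Y)
    (hBX : Disjoint B X) (hBY : Disjoint B Y) (hXY : Disjoint X Y)
    (hval : valFn G α₁ α₂ (A ∪ X) ≤ valFn G α₁ α₂ (B ∪ X))
    (hNAY : closedNbhd G A ∩ Y = ∅) (hNBY : closedNbhd G B ∩ Y = ∅) :
    valFn G α₁ α₂ (A ∪ X ∪ Y) ≤ valFn G α₁ α₂ (B ∪ X ∪ Y) := by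
  rw [valFn_union G α₁ α₂ hXY hNAY, valFn_union G α₁ α₂ hXY hNBY]
  linarith
end

section
/- (Lemma on minimum degree and max (k,n−k)-cut.) Let G = (V,E) be a finite simple graph on n vertices with minimum degree at least r, and let 0 ≤ k ≤ n. Then there exists a subset S ⊆ V with |S| = k such that |E(S, V∖S)| ≥ min{n − k, r·k}, where E(S, V∖S) is the set of edges with exactly one endpoint in S. -/
open Classical

/-- Adjacent pairs crossing from `S` to its complement count distinct cut edges. -/
theorem card_le_cutEdges {V : Type*} [Fintype V] (G : SimpleGraph V) (S : Finset V)
    (P : Finset (V × V)) (hP : ∀ p ∈ P, p.1 ∈ S ∧ p.2 ∉ S ∧ G.Adj p.1 p.2) :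
    P.card ≤ cutEdges G (↑S : Set V) := by
  unfold cutEdges
  rw [← Set.ncard_coe_finset P]
  refine Set.ncard_le_ncard_of_injOn (fun p => s(p.1, p.2)) ?_ ?_ (Set.toFinite _)
  · intro p hp
    obtain ⟨h1, h2, h3⟩ := hP p hp
    exact ⟨h3, ⟨p.1, by simp, h1⟩, ⟨p.2, by simp, h2⟩⟩
  · rintro ⟨a, b⟩ hp ⟨c, d⟩ hq h
    obtain ⟨h1, -, -⟩ := hP _ hp
    obtain ⟨-, h2, -⟩ := hP _ hq
    rcases Sym2.eq_iff.1 h with ⟨rfl, rfl⟩ | ⟨rfl, rfl⟩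
    · rfl
    · exact absurd h1 h2

/-- An independent set in a graph of minimum degree at least `r` has at least
`r * |S|` cut edges. -/
theorem mul_card_le_cutEdges_of_isIndepSet {V : Type*} [Fintype V] (G : SimpleGraph V)
    (r : ℕ) (hmin : ∀ v : V, r ≤ (G.neighborSet v).ncard) (S : Finset V)
    (hS : G.IsIndepSet (↑S : Set V)) : r * S.card ≤ cutEdges G (↑S : Set V) := by
  let P : Finset (V × V) := (S ×ˢ Finset.univ).filter fun p => G.Adj p.1 p.2
  have hcard : r * S.card ≤ P.card := by
    rw [Finset.card_eq_sum_card_fiberwise (f := Prod.fst) (s := P) (t := S)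
      (fun p hp => by simp_all [P]), mul_comm, ← smul_eq_mul]
    refine Finset.card_nsmul_le_sum _ _ _ fun v hv => (hmin v).trans ?_
    rw [← Set.ncard_coe_finset]
    refine Set.ncard_le_ncard_of_injOn (fun w => (v, w)) ?_ ?_ (Set.toFinite _)
    · intro w hw
      simpa [P, hv] using hw
    · intro w _ x _ h
      exact (Prod.ext_iff.1 h).2
  refine hcard.trans (card_le_cutEdges G S P fun p hp => ?_)
  obtain ⟨h1, h2⟩ : p.1 ∈ S ∧ G.Adj p.1 p.2 := by simpa [P] using hp
  exact ⟨h1, fun h => hS h1 h h2.ne h2, h2⟩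

/-- A dominating set has at least as many cut edges as there are vertices outside it. -/
theorem card_sub_le_cutEdges_of_dominating {V : Type*} [Fintype V] (G : SimpleGraph V)
    (S : Finset V) (hS : ∀ v ∉ S, ∃ u ∈ S, G.Adj u v) :
    Fintype.card V - S.card ≤ cutEdges G (↑S : Set V) := by
  choose! f hfS hf using hS
  rw [← Finset.card_compl, ← Finset.card_image_of_injective Sᶜ (f := fun v => (f v, v))
    fun v w h => (Prod.ext_iff.1 h).2]
  refine card_le_cutEdges G S _ fun p hp => ?_
  obtain ⟨v, hv, rfl⟩ := Finset.mem_image.1 hp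
  rw [Finset.mem_compl] at hv
  exact ⟨hfS v hv, hv, hf v hv⟩

/-- In a graph on `n` vertices with minimum degree at least `r`,
for every `0 ≤ k ≤ n` there is a `k`-element set `S` with
`|E(S, V∖S)| ≥ min{n − k, r·k}`. -/
theorem min_degree_cut_lower_bound {V : Type*} [Fintype V] (G : SimpleGraph V)
    (r k : ℕ) (hmin : ∀ v : V, r ≤ (G.neighborSet v).ncard)
    (hk : k ≤ Fintype.card V) :
    ∃ S : Finset V, S.card = k ∧
      min (Fintype.card V - k) (r * k) ≤ cutEdges G (↑S : Set V) := by
  obtain ⟨I, hI⟩ := (Set.toFinite {I : Finset V | G.IsIndepSet (↑I : Set V)}).exists_maximal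
    ⟨∅, by simp [SimpleGraph.IsIndepSet]⟩
  rcases le_total k I.card with h | h
  · obtain ⟨S, hSI, rfl⟩ := Finset.exists_subset_card_eq h
    exact ⟨S, rfl, (min_le_right _ _).trans (mul_card_le_cutEdges_of_isIndepSet G r hmin S
      (Set.Pairwise.mono (Finset.coe_subset.2 hSI) hI.prop))⟩
  · obtain ⟨S, hIS, rfl⟩ := Finset.exists_superset_card_eq h hk
    refine ⟨S, rfl, (min_le_left _ _).trans (card_sub_le_cutEdges_of_dominating G S
      fun v hv => ?_)⟩
    by_contra! hnot
    have hins : G.IsIndepSet (↑(insert v I) : Set V) := by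
      rw [Finset.coe_insert]
      refine Set.Pairwise.insert hI.prop fun u hu _ => ?_
      exact ⟨fun h => hnot u (hIS hu) h.symm, hnot u (hIS hu)⟩
    exact hv (hIS (hI.le_of_ge hins (Finset.subset_insert v I) (Finset.mem_insert_self v I)))
end

section
/- (Corollary of the minimum-degree lemma.) Let G = (V,E) be a finite simple graph on n vertices with no isolated vertices, and let 0 ≤ k ≤ n. Then there exists a subset S ⊆ V with |S| = k such that |E(S, V∖S)| ≥ min{n − k, k}. -/
open Classical

lemma cutEdges_compl {V : Type*} (G : SimpleGraph V) (S : Set V) :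
    cutEdges G Sᶜ = cutEdges G S := by
  unfold cutEdges
  congr 1
  ext e
  simp only [Set.mem_ofPred_eq, Set.mem_compl_iff, not_not]
  tauto

/-- If every vertex of `S` has a neighbor outside `S`, the cut has at least `|S|` edges. -/
lemma card_le_cutEdges_s7 {V : Type*} [Finite V] (G : SimpleGraph V) (S : Finset V)
    (h : ∀ v ∈ S, ∃ u, G.Adj v u ∧ u ∉ S) : S.card ≤ cutEdges G (S : Set V) := by
  choose! f hf using h
  rw [← Set.ncard_coe_finset]
  refine Set.ncard_le_ncard_of_injOn (fun v => s(v, f v)) ?_ ?_ (Set.toFinite _)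
  · intro v hv
    exact ⟨(hf v hv).1, ⟨v, by simp, hv⟩, ⟨f v, by simp, by simpa using (hf v hv).2⟩⟩
  · intro v hv w hw hvw
    rcases Sym2.eq_iff.1 hvw with h | h
    · exact h.1
    · exact absurd (h.1 ▸ hv) (hf w hw).2

/-- A graph without isolated vertices has a vertex partition in which every vertex has a neighbor
in the other part (one part being a maximal independent set). -/
lemma exists_forall_adj_other_side {V : Type*} [Finite V] (G : SimpleGraph V)
    (hiso : ∀ v : V, ∃ u : V, G.Adj v u) :
    ∃ D : Set V, (∀ v ∈ D, ∃ u, G.Adj v u ∧ u ∉ D) ∧ ∀ v ∉ D, ∃ u, G.Adj v u ∧ u ∈ D := by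
  obtain ⟨D, hD⟩ := (Set.toFinite {D : Set V | G.IsIndepSet D}).exists_maximal
    ⟨∅, by simp [SimpleGraph.IsIndepSet]⟩
  have hind : G.IsIndepSet D := hD.prop
  refine ⟨D, fun v hv => ?_, fun v hv => ?_⟩
  · obtain ⟨u, hu⟩ := hiso v
    exact ⟨u, hu, fun huD => hind hv huD hu.ne hu⟩
  · by_contra! hcon
    refine hv (hD.le_of_ge (y := insert v D) ?_ (Set.subset_insert v D) (Set.mem_insert v D))
    exact hind.insert fun b hb _ => ⟨fun hvb => hcon b hvb hb, fun hbv => hcon b hbv.symm hb⟩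

/-- Without isolated vertices, every size up to `n / 2` is attained by a set with a cut at least
that large. -/
lemma exists_card_eq_le_cutEdges {V : Type*} [Fintype V] (G : SimpleGraph V) (k : ℕ)
    (hiso : ∀ v : V, ∃ u : V, G.Adj v u) (hk : 2 * k ≤ Fintype.card V) :
    ∃ S : Finset V, S.card = k ∧ k ≤ cutEdges G (S : Set V) := by
  have key : ∀ A : Finset V, k ≤ A.card → (∀ v ∈ A, ∃ u, G.Adj v u ∧ u ∉ A) →
      ∃ S : Finset V, S.card = k ∧ k ≤ cutEdges G (S : Set V) := by
    intro A hkA hA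
    obtain ⟨S, hSA, hS⟩ := Finset.exists_subset_card_eq hkA
    refine ⟨S, hS, hS ▸ card_le_cutEdges_s7 G S fun v hv => ?_⟩
    obtain ⟨u, hu, huA⟩ := hA v (hSA hv)
    exact ⟨u, hu, fun huS => huA (hSA huS)⟩
  obtain ⟨D, hD, hDc⟩ := exists_forall_adj_other_side G hiso
  have hcard := Finset.card_add_card_compl D.toFinset
  rcases le_or_gt k D.toFinset.card with h | h
  · exact key D.toFinset h (by simpa using hD)
  · exact key D.toFinsetᶜ (by omega) (by simpa using hDc)

/-- In a graph on `n` vertices with no isolated vertices, for every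
`0 ≤ k ≤ n` there is a `k`-element set `S` with `|E(S, V∖S)| ≥ min{n − k, k}`. -/
theorem no_isolated_cut_lower_bound {V : Type*} [Fintype V] (G : SimpleGraph V)
    (k : ℕ) (hiso : ∀ v : V, ∃ u : V, G.Adj v u)
    (hk : k ≤ Fintype.card V) :
    ∃ S : Finset V, S.card = k ∧
      min (Fintype.card V - k) k ≤ cutEdges G (↑S : Set V) := by
  rcases le_total (2 * k) (Fintype.card V) with h | h
  · obtain ⟨S, hS, hcut⟩ := exists_card_eq_le_cutEdges G k hiso h
    exact ⟨S, hS, (min_le_right _ _).trans hcut⟩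
  · obtain ⟨S, hS, hcut⟩ :=
      exists_card_eq_le_cutEdges G (Fintype.card V - k) hiso (by omega)
    refine ⟨Sᶜ, by rw [Finset.card_compl]; omega, (min_le_left _ _).trans ?_⟩
    rwa [Finset.coe_compl, cutEdges_compl]
end

section
/- (Swap step in the proof of the minimum-degree lemma.) Let G = (V,E) be a finite simple graph with vertex set partitioned into V₁ and V₂, and let r ≥ 1. Suppose v ∈ V₂ has all its neighbors in V₂ and deg(v) ≥ r, and suppose v' ∈ V₁ has strictly fewer than r neighbors in V₂. Then the partition (V₁', V₂') obtained by swapping v and v' (i.e., V₁' = (V₁ ∖ {v'}) ∪ {v}) satisfies |E(V₁', V∖V₁')| ≥ |E(V₁, V∖V₁)| + 1. -/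
open Classical

/-- The edges joining a vertex `a` to a set `T` of vertices are as numerous as `T`. -/
theorem ncard_image_sym2_mk {V : Type*} (a : V) (T : Set V) :
    ((fun u => s(a, u)) '' T).ncard = T.ncard :=
  Set.ncard_image_of_injective T fun _ _ h => Sym2.congr_right.mp h

/-- Swap step: if `v ∈ V₂ = V∖V₁` has all its neighbors in `V₂` and
degree at least `r ≥ 1`, and `v' ∈ V₁` has fewer than `r` neighbors in `V₂`, then
swapping `v` and `v'` increases the cut by at least 1. -/
theorem swap_increases_cut {V : Type*} [Fintype V] (G : SimpleGraph V)
    (V₁ : Set V) (r : ℕ) (hr : 1 ≤ r) (v v' : V)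
    (hv : v ∈ V₁ᶜ) (hvnbrs : G.neighborSet v ⊆ V₁ᶜ)
    (hvdeg : r ≤ (G.neighborSet v).ncard)
    (hv' : v' ∈ V₁) (hv'nbrs : (G.neighborSet v' ∩ V₁ᶜ).ncard < r) :
    cutEdges G V₁ + 1 ≤ cutEdges G ((V₁ \ {v'}) ∪ {v}) := by
  simp only [Set.mem_compl_iff] at hv
  have hsub : ∀ u, G.Adj v u → u ∉ V₁ := fun u hu => hvnbrs hu
  unfold cutEdges
  set C := {e ∈ G.edgeSet | (∃ x ∈ e, x ∈ V₁) ∧ ∃ x ∈ e, x ∉ V₁}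
  set C' := {e ∈ G.edgeSet | (∃ x ∈ e, x ∈ V₁ \ {v'} ∪ {v}) ∧
    ∃ x ∈ e, x ∉ V₁ \ {v'} ∪ {v}}
  set A := (fun u => s(v, u)) '' G.neighborSet v
  set B := (fun u => s(v', u)) '' (G.neighborSet v' ∩ V₁ᶜ)
  have hAcard : A.ncard = (G.neighborSet v).ncard := ncard_image_sym2_mk v _
  have hBcard : B.ncard = (G.neighborSet v' ∩ V₁ᶜ).ncard := ncard_image_sym2_mk v' _
  have hAC' : A ⊆ C' := by
    rintro _ ⟨u, hu, rfl⟩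
    refine ⟨hu, ⟨v, Sym2.mem_mk_left v u, Or.inr rfl⟩, u, Sym2.mem_mk_right v u, ?_⟩
    rintro (h | h)
    · exact hsub u hu h.1
    · exact G.ne_of_adj hu h.symm
  have hdisj : Disjoint (C \ B) A := by
    refine Set.disjoint_left.mpr ?_
    rintro _ ⟨⟨_, ⟨x, hx, hx₁⟩, _⟩, _⟩ ⟨u, hu, rfl⟩
    rcases Sym2.mem_iff.mp hx with rfl | rfl
    · exact hv hx₁
    · exact hsub _ hu hx₁
  have hCB : C \ B ⊆ C' := by
    rintro e ⟨⟨he, ⟨x, hx, hx₁⟩, y, hy, hy₁⟩, heB⟩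
    have hxy : x ≠ y := fun h => hy₁ (h ▸ hx₁)
    obtain rfl : e = s(x, y) := (Sym2.mem_and_mem_iff hxy).mp ⟨hx, hy⟩
    have hadj : G.Adj x y := he
    refine ⟨he, ⟨x, hx, Or.inl ⟨hx₁, ?_⟩⟩, y, hy, ?_⟩
    · rintro rfl
      exact heB ⟨y, ⟨hadj, hy₁⟩, rfl⟩
    · rintro (h | rfl)
      · exact hy₁ h.1
      · exact hsub x hadj.symm hx₁
  have hunion : (C \ B).ncard + A.ncard ≤ C'.ncard := by
    rw [← Set.ncard_union_eq hdisj]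
    exact Set.ncard_le_ncard (Set.union_subset hCB hAC')
  have hdiff : C.ncard ≤ (C \ B).ncard + B.ncard := Set.ncard_le_ncard_sdiff_add_ncard C B
  omega
end

section
/- (Approximation guarantee of the greedy top-degree choice for max (k,n−k)-cut.) Let G = (V,E) be a finite simple graph with maximum degree Δ ≥ 1, and let S ⊆ V with |S| = k be a set of k vertices of largest degree (i.e., deg(u) ≥ deg(w) for every u ∈ S and w ∈ V∖S). Then for every subset S' ⊆ V with |S'| = k, |E(S, V∖S)| ≥ (1 − k²/Δ)·|E(S', V∖S')| (as an inequality of real numbers). -/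
open Classical

theorem cutEdges_coe_eq_sum {V : Type*} [Fintype V] (G : SimpleGraph V) (S : Finset V) :
    cutEdges G (S : Set V) = ∑ u ∈ S, (G.neighborFinset u \ S).card := by
  rw [← Finset.card_sigma, cutEdges, ← Set.ncard_coe_finset]
  symm
  refine Set.ncard_congr (fun p _ => s(p.1, p.2)) ?_ ?_ ?_
  · rintro ⟨u, w⟩ h
    simp only [Finset.mem_coe, Finset.mem_sigma, Finset.mem_sdiff,
      SimpleGraph.mem_neighborFinset] at h
    exact ⟨h.2.1, ⟨u, Sym2.mem_mk_left u w, h.1⟩, ⟨w, Sym2.mem_mk_right u w, h.2.2⟩⟩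
  · rintro ⟨u, w⟩ ⟨u', w'⟩ h h' heq
    simp only [Finset.mem_coe, Finset.mem_sigma, Finset.mem_sdiff] at h h'
    rcases Sym2.eq_iff.mp heq with ⟨rfl, rfl⟩ | ⟨rfl, rfl⟩
    · rfl
    · exact absurd h.1 h'.2.2
  · intro e
    induction e using Sym2.ind with
    | _ x y =>
      rintro ⟨hadj, ⟨a, ha, haS⟩, ⟨b, hb, hbS⟩⟩
      have hxy : G.Adj x y := hadj
      simp only [Finset.mem_coe] at haS hbS
      refine ⟨⟨a, b⟩, ?_, ?_⟩
      · simp only [Finset.mem_coe, Finset.mem_sigma, Finset.mem_sdiff,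
          SimpleGraph.mem_neighborFinset]
        refine ⟨haS, ?_, hbS⟩
        rcases Sym2.mem_iff.mp ha with rfl | rfl <;> rcases Sym2.mem_iff.mp hb with rfl | rfl
        · exact absurd haS hbS
        · exact hxy
        · exact hxy.symm
        · exact absurd haS hbS
      · rcases Sym2.mem_iff.mp ha with rfl | rfl <;> rcases Sym2.mem_iff.mp hb with rfl | rfl
        · exact absurd haS hbS
        · rfl
        · exact Sym2.eq_swap
        · exact absurd haS hbS

theorem cutEdges_le_sum_degree {V : Type*} [Fintype V] (G : SimpleGraph V) (S : Finset V) :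
    cutEdges G (S : Set V) ≤ ∑ u ∈ S, G.degree u := by
  rw [cutEdges_coe_eq_sum]
  exact Finset.sum_le_sum fun u _ => Finset.card_le_card Finset.sdiff_subset

theorem sum_degree_le_cutEdges_add_sq {V : Type*} [Fintype V] (G : SimpleGraph V)
    (S : Finset V) :
    ∑ u ∈ S, G.degree u ≤ cutEdges G (S : Set V) + S.card ^ 2 := by
  have hsq : S.card ^ 2 = ∑ _u ∈ S, S.card := by simp [sq]
  rw [cutEdges_coe_eq_sum, hsq, ← Finset.sum_add_distrib]
  exact Finset.sum_le_sum fun u _ => Finset.card_le_card_sdiff_add_card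

/-- A set of elements with the largest weights maximizes the total weight among sets of
its cardinality. -/
theorem Finset.sum_le_sum_of_top {α : Type*} (f : α → ℕ) (S T : Finset α)
    (hcard : T.card = S.card) (htop : ∀ u ∈ S, ∀ w ∉ S, f w ≤ f u) :
    ∑ w ∈ T, f w ≤ ∑ u ∈ S, f u := by
  rw [← Finset.sum_inter_add_sum_sdiff T S, ← Finset.sum_inter_add_sum_sdiff S T,
    Finset.inter_comm]
  gcongr _ + ?_
  calc ∑ w ∈ T \ S, f w ≤ (T \ S).card • (T \ S).sup f :=
        Finset.sum_le_card_nsmul _ _ _ fun w hw => Finset.le_sup hw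
    _ = (S \ T).card • (T \ S).sup f := by rw [Finset.card_sdiff_comm hcard]
    _ ≤ ∑ u ∈ S \ T, f u := Finset.card_nsmul_le_sum _ _ _ fun u hu =>
        Finset.sup_le fun w hw =>
          htop u (Finset.mem_sdiff.mp hu).1 w (Finset.mem_sdiff.mp hw).2

/-- Approximation guarantee of the greedy top-degree choice: if `Δ ≥ 1`
is the maximum degree and `S` consists of `k` vertices of largest degree, then for
every `k`-element subset `S'`, `|E(S, V∖S)| ≥ (1 − k²/Δ)·|E(S', V∖S')|`. -/
theorem greedy_top_degree_approx {V : Type*} [Fintype V] (G : SimpleGraph V)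
    (Δ : ℕ) (hΔ1 : 1 ≤ Δ)
    (hΔub : ∀ v : V, (G.neighborSet v).ncard ≤ Δ)
    (hΔex : ∃ v : V, (G.neighborSet v).ncard = Δ)
    (k : ℕ) (S : Finset V) (hScard : S.card = k)
    (htop : ∀ u ∈ S, ∀ w ∉ S, (G.neighborSet w).ncard ≤ (G.neighborSet u).ncard) :
    ∀ S' : Finset V, S'.card = k →
      (1 - (k : ℝ) ^ 2 / (Δ : ℝ)) * (cutEdges G (↑S' : Set V) : ℝ)
        ≤ (cutEdges G (↑S : Set V) : ℝ) := by
  intro S' hS'card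
  have hdeg : ∀ v, (G.neighborSet v).ncard = G.degree v := fun v => by
    rw [← SimpleGraph.card_neighborSet_eq_degree, ← Nat.card_coe_set_eq, Nat.card_eq_fintype_card]
  simp only [hdeg] at hΔex htop
  have hΔpos : (0 : ℝ) < Δ := by exact_mod_cast hΔ1
  have hcut' : cutEdges G (S' : Set V) ≤ ∑ u ∈ S, G.degree u :=
    (cutEdges_le_sum_degree G S').trans
      (Finset.sum_le_sum_of_top _ S S' (hS'card.trans hScard.symm) htop)
  have hcut := sum_degree_le_cutEdges_add_sq G S
  rw [hScard] at hcut
  rcases S.eq_empty_or_nonempty with rfl | ⟨u, hu⟩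
  · have hzero : cutEdges G (S' : Set V) = 0 := by simpa using hcut'
    simp [hzero]
  have hΔsum : Δ ≤ ∑ u ∈ S, G.degree u := by
    obtain ⟨v, rfl⟩ := hΔex
    have hle : ∀ x ∈ S, G.degree x ≤ ∑ u ∈ S, G.degree u := fun x hx =>
      Finset.single_le_sum (f := fun u => G.degree u) (fun _ _ => Nat.zero_le _) hx
    by_cases hv : v ∈ S
    · exact hle v hv
    · exact (htop u hu v hv).trans (hle u hu)
  generalize ∑ u ∈ S, G.degree u = D at hcut hcut' hΔsum
  have hcutR : (D : ℝ) ≤ cutEdges G (S : Set V) + (k : ℝ) ^ 2 := by exact_mod_cast hcut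
  have hcutR' : (cutEdges G (S' : Set V) : ℝ) ≤ D := by exact_mod_cast hcut'
  have hΔR : (Δ : ℝ) ≤ D := by exact_mod_cast hΔsum
  rcases le_total (1 - (k : ℝ) ^ 2 / Δ) 0 with hneg | hnonneg
  · exact (mul_nonpos_of_nonpos_of_nonneg hneg (Nat.cast_nonneg _)).trans (Nat.cast_nonneg _)
  · have hmul : (k : ℝ) ^ 2 ≤ (k : ℝ) ^ 2 / Δ * D := by
      rw [div_mul_eq_mul_div, le_div_iff₀ hΔpos]
      gcongr
    calc (1 - (k : ℝ) ^ 2 / Δ) * (cutEdges G (S' : Set V) : ℝ)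
        ≤ (1 - (k : ℝ) ^ 2 / Δ) * D := by gcongr
      _ ≤ (cutEdges G (S : Set V) : ℝ) := by linarith
end
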